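/- (Liveness Theorem) In a regular run, suppose 0 ≤ α and α + d_open < β − D_close, where D_close = d_close + (d_max − d_min). If the crossing is empty throughout the open interval (α,β), i.e., TrackStatus(x,t) ≠ incrossing for every track x and every t ∈ (α,β), then GateStatus(t) = opened for every t ∈ [α + d_open, β − D_close]. -/

import Mathlib

namespace RailCross

inductive TStat : Type
  | emp | coming | incrossing
deriving DecidableEq

inductive DirV : Type
  | opn | cls
deriving DecidableEq

inductive GateV : Type
  | opened | closed
deriving DecidableEq

/-- `f` is piecewise constant on `[0, ∞)`: for every `τ > 0` there is a finite
partition `0 = s 0 < s 1 < … < s n = τ` such that `f` is constant on each open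
subinterval `(s i, s (i+1))`. -/
def PWC {Y : Type*} (f : ℝ → Y) : Prop :=
  ∀ τ : ℝ, 0 < τ → ∃ n : ℕ, ∃ s : ℕ → ℝ,
    s 0 = 0 ∧ s n = τ ∧ (∀ i < n, s i < s (i + 1)) ∧
    (∀ i < n, ∀ a b : ℝ, s i < a → a < b → b < s (i + 1) → f a = f b)

/-- `v` is the right-hand value `f(t+)`: `f` is constantly `v` on some `(t, t+ε)`. -/
def RightVal {Y : Type*} (f : ℝ → Y) (t : ℝ) (v : Y) : Prop :=
  ∃ ε : ℝ, 0 < ε ∧ ∀ u : ℝ, t < u → u < t + ε → f u = v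

/-- `v` is the left-hand value `f(t−)` (for `t > 0`): `f` is constantly `v` on some `(t-ε, t)`. -/
def LeftVal {Y : Type*} (f : ℝ → Y) (t : ℝ) (v : Y) : Prop :=
  ∃ ε : ℝ, 0 < ε ∧ ε ≤ t ∧ ∀ u : ℝ, t - ε < u → u < t → f u = v

/-- `tm` is the (finite or infinite) increasing sequence of significant moments of a
track with status function `f`; a finite sequence is encoded by letting `tm` take the
value `⊤ = ∞` from some point on. -/
structure TrainMotion (dmin dmax : ℝ) (f : ℝ → TStat) (tm : ℕ → EReal) : Prop where
  zero : tm 0 = 0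
  mono : Monotone tm
  strict : ∀ i, tm i ≠ ⊤ → tm i < tm (i + 1)
  last_div : ∀ k, tm k ≠ ⊤ → tm (k + 1) = ⊤ → 3 ∣ k
  status_empty : ∀ i : ℕ, ∀ u : ℝ, tm (3 * i) ≤ (u : EReal) → (u : EReal) < tm (3 * i + 1) →
    f u = TStat.emp
  status_coming : ∀ i : ℕ, ∀ u : ℝ, tm (3 * i + 1) ≤ (u : EReal) → (u : EReal) < tm (3 * i + 2) →
    f u = TStat.coming
  status_cross : ∀ i : ℕ, ∀ u : ℝ, tm (3 * i + 2) ≤ (u : EReal) → (u : EReal) < tm (3 * i + 3) →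
    f u = TStat.incrossing
  gap : ∀ i : ℕ, ∀ a b : ℝ, tm (3 * i + 1) = (a : EReal) → tm (3 * i + 2) = (b : EReal) →
    dmin ≤ b - a ∧ b - a ≤ dmax

/-- `SafeToOpen(t)`: every track is empty or its deadline is more than `dopen` away. -/
def SafeToOpen {Tracks : Type*} (dopen : ℝ) (trackStatus : Tracks → ℝ → TStat)
    (deadline : Tracks → ℝ → EReal) (t : ℝ) : Prop :=
  ∀ x : Tracks, trackStatus x t = TStat.emp ∨ ((t + dopen : ℝ) : EReal) < deadline x t

/-- A regular run of the railroad-crossing evolving algebra.  `WaitTime = dmin - dclose`. -/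
structure RegularRun (Tracks : Type*) (dmin dmax dopen dclose : ℝ) where
  trackStatus : Tracks → ℝ → TStat
  deadline : Tracks → ℝ → EReal
  dir : ℝ → DirV
  gate : ℝ → GateV
  /-- the right-hand value `Deadline(x, t+)` -/
  deadlinePlus : Tracks → ℝ → EReal
  /-- the right-hand value `Dir(t+)` -/
  dirPlus : ℝ → DirV
  /-- the right-hand value `GateStatus(t+)` -/
  gatePlus : ℝ → GateV
  pwc_ts : ∀ x, PWC (trackStatus x)
  pwc_dl : ∀ x, PWC (deadline x)
  pwc_dir : PWC dir
  pwc_gate : PWC gate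
  dlPlus_spec : ∀ x, ∀ t : ℝ, 0 ≤ t → RightVal (deadline x) t (deadlinePlus x t)
  dirPlus_spec : ∀ t : ℝ, 0 ≤ t → RightVal dir t (dirPlus t)
  gatePlus_spec : ∀ t : ℝ, 0 ≤ t → RightVal gate t (gatePlus t)
  dl_left : ∀ x, ∀ t : ℝ, 0 < t → LeftVal (deadline x) t (deadline x t)
  dir_left : ∀ t : ℝ, 0 < t → LeftVal dir t (dir t)
  gate_left : ∀ t : ℝ, 0 < t → LeftVal gate t (gate t)
  trainMotion : ∀ x, ∃ tm : ℕ → EReal, TrainMotion dmin dmax (trackStatus x) tm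
  dl_init : ∀ x, deadline x 0 = ⊤
  dir_init : dir 0 = DirV.opn
  gate_init : gate 0 = GateV.opened
  dl_step_coming : ∀ x, ∀ t : ℝ, 0 ≤ t → trackStatus x t = TStat.coming → deadline x t = ⊤ →
    deadlinePlus x t = ((t + (dmin - dclose) : ℝ) : EReal)
  dl_step_empty : ∀ x, ∀ t : ℝ, 0 ≤ t → trackStatus x t = TStat.emp → deadline x t ≠ ⊤ →
    deadlinePlus x t = ⊤
  dl_step_other : ∀ x, ∀ t : ℝ, 0 ≤ t →
    ¬(trackStatus x t = TStat.coming ∧ deadline x t = ⊤) →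
    ¬(trackStatus x t = TStat.emp ∧ deadline x t ≠ ⊤) →
    deadlinePlus x t = deadline x t
  dir_step_close : ∀ t : ℝ, 0 ≤ t → (∃ x, deadline x t = (t : EReal)) → dirPlus t = DirV.cls
  dir_step_open : ∀ t : ℝ, 0 ≤ t → (∀ x, deadline x t ≠ (t : EReal)) → dir t = DirV.cls →
    SafeToOpen dopen trackStatus deadline t → dirPlus t = DirV.opn
  dir_step_other : ∀ t : ℝ, 0 ≤ t → (∀ x, deadline x t ≠ (t : EReal)) →
    ¬(dir t = DirV.cls ∧ SafeToOpen dopen trackStatus deadline t) → dirPlus t = dir t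
  gate_step : ∀ t : ℝ, 0 ≤ t →
    gatePlus t = gate t ∨ (dir t = DirV.opn ∧ gatePlus t = GateV.opened) ∨
      (dir t = DirV.cls ∧ gatePlus t = GateV.closed)
  gate_close_bound : ∀ t : ℝ, 0 ≤ t →
    ¬(∀ u ∈ Set.Ioo t (t + dclose), dir u = DirV.cls ∧ gate u = GateV.opened)
  gate_open_bound : ∀ t : ℝ, 0 ≤ t →
    ¬(∀ u ∈ Set.Ioo t (t + dopen), dir u = DirV.opn ∧ gate u = GateV.closed)

/-- Propagation of a value to the right for a function with one-sided limits that is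
left-continuous: if the right-hand value at `a` is `v`, and the value `v` is never left
on `(a, b)`, then `f = v` on `(a, b]`. -/
theorem eq_on_Ioc_of_step {Y : Type*} {f fPlus : ℝ → Y} {a b : ℝ} {v : Y} (ha : 0 ≤ a)
    (hright : ∀ t, 0 ≤ t → RightVal f t (fPlus t))
    (hleft : ∀ t, 0 < t → LeftVal f t (f t))
    (hstart : fPlus a = v) (hstep : ∀ t, a < t → t < b → f t = v → fPlus t = v) :
    ∀ t, a < t → t ≤ b → f t = v := by
  intro t hat htb
  by_contra hne
  set B : Set ℝ := {u | a < u ∧ u ≤ b ∧ f u ≠ v} with hB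
  have hBne : B.Nonempty := ⟨t, hat, htb, hne⟩
  have hBbdd : BddBelow B := ⟨a, fun u hu => hu.1.le⟩
  have hm_le : ∀ u ∈ B, sInf B ≤ u := fun u hu => csInf_le hBbdd hu
  have ham : a ≤ sInf B := le_csInf hBne fun u hu => hu.1.le
  have hmt : sInf B ≤ t := hm_le t ⟨hat, htb, hne⟩
  have hgood : ∀ u, a < u → u < sInf B → f u = v := by
    intro u hau hum
    by_contra h
    exact absurd (hm_le u ⟨hau, by linarith, h⟩) (not_le.mpr hum)
  have hm_good : a < sInf B → f (sInf B) = v := by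
    intro h
    obtain ⟨ε, hε, -, hf⟩ := hleft (sInf B) (by linarith)
    obtain ⟨u, hu, hum⟩ := exists_between (max_lt h (sub_lt_self (sInf B) hε))
    rw [← hf u ((le_max_right _ _).trans_lt hu) hum]
    exact hgood u ((le_max_left _ _).trans_lt hu) hum
  have hm_plus : fPlus (sInf B) = v := by
    rcases ham.eq_or_lt with h | h
    · rw [← h, hstart]
    · refine hstep _ h ((hmt.trans htb).lt_of_ne ?_) (hm_good h)
      intro hmb
      exact hne ((le_antisymm hmt (hmb ▸ htb)) ▸ hm_good h)
  obtain ⟨ε, hε, hf⟩ := hright (sInf B) (by linarith)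
  obtain ⟨u, hu, huε⟩ := exists_lt_of_csInf_lt hBne (lt_add_of_pos_right (sInf B) hε)
  rcases (hm_le u hu).eq_or_lt with h | h
  · exact hu.2.2 (h ▸ hm_good (h ▸ hu.1))
  · exact hu.2.2 ((hf u h huε).trans hm_plus)

namespace TrainMotion

variable {dmin dmax : ℝ} {f : ℝ → TStat} {tm : ℕ → EReal}

theorem nonneg (h : TrainMotion dmin dmax f tm) (n : ℕ) : 0 ≤ tm n :=
  h.zero ▸ h.mono (Nat.zero_le n)

theorem exists_real (h : TrainMotion dmin dmax f tm) {n : ℕ} (hn : tm n ≠ ⊤) :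
    ∃ a : ℝ, tm n = a ∧ 0 ≤ a := by
  have h0 := h.nonneg n
  have hbot : tm n ≠ ⊥ := fun hb => by simp [hb] at h0
  refine ⟨(tm n).toReal, (EReal.coe_toReal hn hbot).symm, EReal.toReal_nonneg h0⟩

theorem mul_dmin_le (h : TrainMotion dmin dmax f tm) (i : ℕ) :
    ((i * dmin : ℝ) : EReal) ≤ tm (3 * i) := by
  induction i with
  | zero => simpa using h.nonneg 0
  | succ i ih =>
    refine le_trans ?_ (h.mono (show 3 * i + 2 ≤ 3 * (i + 1) by lia))
    by_cases h2 : tm (3 * i + 2) = ⊤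
    · simp [h2]
    have h1 : tm (3 * i + 1) ≠ ⊤ := fun h1 =>
      h2 (top_le_iff.mp (h1 ▸ h.mono (show 3 * i + 1 ≤ 3 * i + 2 by lia)))
    obtain ⟨b, hb, -⟩ := h.exists_real h2
    obtain ⟨a, ha, -⟩ := h.exists_real h1
    have hgap := (h.gap i a b ha hb).1
    have hia : i * dmin ≤ a := by
      have := ih.trans (h.mono (show 3 * i ≤ 3 * i + 1 by lia))
      rw [ha] at this
      exact_mod_cast this
    rw [hb, EReal.coe_le_coe_iff]
    push_cast
    linarith

/-- Every time lies between two consecutive significant moments. -/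
theorem exists_mem_Ico (h : TrainMotion dmin dmax f tm) (hdmin : 0 < dmin) {t : ℝ} (ht : 0 ≤ t) :
    ∃ n, tm n ≤ t ∧ (t : EReal) < tm (n + 1) := by
  classical
  have hex : ∃ n, (t : EReal) < tm n := by
    obtain ⟨i, hi⟩ := exists_nat_gt (t / dmin)
    rw [div_lt_iff₀ hdmin] at hi
    exact ⟨3 * i, (EReal.coe_lt_coe_iff.mpr hi).trans_le (h.mul_dmin_le i)⟩
  have hpos : Nat.find hex ≠ 0 := by
    intro h0
    have := Nat.find_spec hex
    rw [h0, h.zero] at this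
    exact absurd ht (not_le.mpr (by exact_mod_cast this))
  obtain ⟨n, hn⟩ := Nat.exists_eq_succ_of_ne_zero hpos
  refine ⟨n, not_lt.mp (Nat.find_min hex (by lia)), ?_⟩
  have := Nat.find_spec hex
  rwa [hn] at this

theorem coming_end_ne_top (h : TrainMotion dmin dmax f tm) {i : ℕ} (h1 : tm (3 * i + 1) ≠ ⊤) :
    tm (3 * i + 2) ≠ ⊤ := fun h2 => by
  have := h.last_div _ h1 h2
  lia

end TrainMotion

namespace RegularRun

variable {Tracks : Type*} {dmin dmax dopen dclose : ℝ}

/-- The deadline is infinite once a track has been empty for a positive time. -/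
theorem deadline_eq_top_of_empty (R : RegularRun Tracks dmin dmax dopen dclose) (x : Tracks)
    {a b : ℝ} (ha : 0 ≤ a) (hemp : ∀ u, a ≤ u → u < b → R.trackStatus x u = TStat.emp)
    {t : ℝ} (hat : a < t) (htb : t ≤ b) : R.deadline x t = ⊤ := by
  have hplus : ∀ u, a ≤ u → u < b → R.deadlinePlus x u = ⊤ := by
    intro u hau hub
    have he := hemp u hau hub
    by_cases hd : R.deadline x u = ⊤
    · rw [← hd]
      exact R.dl_step_other x u (ha.trans hau) (by simp [he]) (by simp [hd])
    · exact R.dl_step_empty x u (ha.trans hau) he hd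
  exact eq_on_Ioc_of_step ha (R.dlPlus_spec x) (R.dl_left x)
    (hplus a le_rfl (hat.trans_le htb)) (fun u hau hub _ => hplus u hau.le hub) t hat htb

/-- While a train is coming, the deadline keeps the value it was given on arrival. -/
theorem deadline_eq_of_coming (R : RegularRun Tracks dmin dmax dopen dclose) (x : Tracks)
    {a b : ℝ} (ha : 0 ≤ a) (hcom : ∀ u, a ≤ u → u < b → R.trackStatus x u = TStat.coming)
    (htop : R.deadline x a = ⊤) {t : ℝ} (hat : a < t) (htb : t ≤ b) :
    R.deadline x t = ((a + (dmin - dclose) : ℝ) : EReal) := by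
  refine eq_on_Ioc_of_step ha (R.dlPlus_spec x) (R.dl_left x)
    (R.dl_step_coming x a ha (hcom a le_rfl (hat.trans_le htb)) htop) ?_ t hat htb
  intro u hau hub hu
  rw [← hu]
  refine R.dl_step_other x u (ha.trans hau.le) ?_ (by simp [hcom u hau.le hub])
  rintro ⟨-, h⟩
  exact EReal.coe_ne_top _ (hu.symm.trans h)

theorem le_deadline_of_no_crossing (R : RegularRun Tracks dmin dmax dopen dclose)
    (hdmin : 0 < dmin) {α β : ℝ} (hα : 0 ≤ α) (x : Tracks)
    (hempty : ∀ t ∈ Set.Ioo α β, R.trackStatus x t ≠ TStat.incrossing)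
    {t : ℝ} (ht : t ∈ Set.Ioo α β) :
    ((β - (dclose + (dmax - dmin)) : ℝ) : EReal) ≤ R.deadline x t := by
  obtain ⟨tm, h⟩ := R.trainMotion x
  obtain ⟨hαt, htβ⟩ := ht
  obtain ⟨n, hn, hn'⟩ := h.exists_mem_Ico hdmin (hα.trans hαt.le)
  have htop : ∀ k, tm k ≤ t → tm k ≠ ⊤ := fun k hk hk' =>
    absurd (hk' ▸ hk) (not_le.mpr (EReal.coe_lt_top t))
  have hmod : n = 3 * (n / 3) ∨ n = 3 * (n / 3) + 1 ∨ n = 3 * (n / 3) + 2 := by lia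
  generalize n / 3 = i at hmod
  rcases hmod with rfl | rfl | rfl
  · obtain ⟨a, ha, ha0⟩ := h.exists_real (htop _ hn)
    have hat : a ≤ t := by rw [ha] at hn; exact_mod_cast hn
    have hlt : a < t := by
      refine hat.lt_of_ne ?_
      rintro rfl
      cases i with
      | zero =>
        have : a = 0 := by rw [Nat.mul_zero, h.zero] at ha; exact_mod_cast ha.symm
        linarith
      | succ j =>
        have hc := h.mono (show 3 * j + 2 ≤ 3 * (j + 1) by lia)
        obtain ⟨c, hc', -⟩ := h.exists_real (htop _ (hc.trans hn))
        have hca : c < a := by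
          have := h.strict (3 * j + 2) (htop _ (hc.trans hn))
          rw [hc', show 3 * j + 2 + 1 = 3 * (j + 1) by lia, ha] at this
          exact_mod_cast this
        obtain ⟨u, hu, hua⟩ := exists_between (max_lt hαt hca)
        refine hempty u ⟨(le_max_left _ _).trans_lt hu, hua.trans htβ⟩
          (h.status_cross j u ?_ ?_)
        · rw [hc']
          exact_mod_cast ((le_max_right _ _).trans_lt hu).le
        · rw [show 3 * j + 3 = 3 * (j + 1) by lia, ha]
          exact_mod_cast hua
    rw [R.deadline_eq_top_of_empty x ha0 (fun u hau hut => h.status_empty i u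
      (ha ▸ EReal.coe_le_coe_iff.mpr hau) ((EReal.coe_lt_coe_iff.mpr hut).trans hn')) hlt le_rfl]
    exact le_top
  · have h1 := htop _ hn
    have h2 := h.coming_end_ne_top h1
    have h01 := h.mono (show 3 * i ≤ 3 * i + 1 by lia)
    have h0 := htop _ (h01.trans hn)
    obtain ⟨c, hc, hc0⟩ := h.exists_real h0
    obtain ⟨a, ha, ha0⟩ := h.exists_real h1
    obtain ⟨b, hb, -⟩ := h.exists_real h2
    have hca : c < a := by
      have := h.strict _ h0
      rw [hc, ha] at this
      exact_mod_cast this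
    have hat : a ≤ t := by rw [ha] at hn; exact_mod_cast hn
    have htb : t < b := by
      rw [show 3 * i + 1 + 1 = 3 * i + 2 by lia, hb] at hn'
      exact_mod_cast hn'
    have hda : R.deadline x a = ⊤ := R.deadline_eq_top_of_empty x hc0
      (fun u hcu hua => h.status_empty i u (hc ▸ EReal.coe_le_coe_iff.mpr hcu)
        (ha ▸ EReal.coe_lt_coe_iff.mpr hua)) hca le_rfl
    rcases hat.eq_or_lt with rfl | hlt
    · rw [hda]
      exact le_top
    have hβb : β ≤ b := by
      by_contra! hbβ
      exact hempty b ⟨hαt.trans htb, hbβ⟩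
        (h.status_cross i b hb.le (hb ▸ h.strict _ h2))
    rw [R.deadline_eq_of_coming x ha0 (fun u hau hub => h.status_coming i u
      (ha ▸ EReal.coe_le_coe_iff.mpr hau) (hb ▸ EReal.coe_lt_coe_iff.mpr hub)) hda hlt htb.le,
      EReal.coe_le_coe_iff]
    linarith [(h.gap i a b ha hb).2]
  · exact absurd (h.status_cross i t hn hn') (hempty t ⟨hαt, htβ⟩)

end RegularRun

theorem liveness_theorem {Tracks : Type*} [Fintype Tracks] [Nonempty Tracks]
    {dmin dmax dopen dclose : ℝ}
    (hdmin : 0 < dmin) (hdmax : 0 < dmax) (hdopen : 0 < dopen) (hdclose : 0 < dclose)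
    (hcm : dclose < dmin) (hmm : dmin ≤ dmax)
    (R : RegularRun Tracks dmin dmax dopen dclose)
    (α β : ℝ) (hα : 0 ≤ α) (hαβ : α + dopen < β - (dclose + (dmax - dmin)))
    (hempty : ∀ x : Tracks, ∀ t ∈ Set.Ioo α β, R.trackStatus x t ≠ TStat.incrossing) :
    ∀ t ∈ Set.Icc (α + dopen) (β - (dclose + (dmax - dmin))), R.gate t = GateV.opened := by
  have hDβ : β - (dclose + (dmax - dmin)) < β := by linarith
  set γ : ℝ := β - (dclose + (dmax - dmin)) with hγ
  have hdl : ∀ x t, α < t → t < β → (γ : EReal) ≤ R.deadline x t := fun x t h₁ h₂ =>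
    R.le_deadline_of_no_crossing hdmin hα x (hempty x) ⟨h₁, h₂⟩
  have hne : ∀ t, α < t → t < γ → ∀ x, R.deadline x t ≠ (t : EReal) := by
    intro t h₁ h₂ x h
    have := hdl x t h₁ (h₂.trans hDβ)
    rw [h, EReal.coe_le_coe_iff] at this
    linarith
  have hkeep : ∀ t, α < t → t < γ → R.dir t = DirV.opn → R.dirPlus t = DirV.opn := by
    intro t h₁ h₂ h
    rw [← h]
    exact R.dir_step_other t (by linarith) (hne t h₁ h₂) (by simp [h])
  have hstart : ∀ t, α < t → t + dopen < γ → R.dirPlus t = DirV.opn := by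
    intro t h₁ h₂
    cases hd : R.dir t with
    | opn => exact hkeep t h₁ (by linarith) hd
    | cls =>
      exact R.dir_step_open t (by linarith) (hne t h₁ (by linarith)) hd fun x =>
        Or.inr ((EReal.coe_lt_coe_iff.mpr h₂).trans_le (hdl x t h₁ (by linarith)))
  have hdir : ∀ t, α < t → t ≤ γ → R.dir t = DirV.opn := by
    intro t h₁ h₂
    obtain ⟨s, hs, hs'⟩ := exists_between (lt_min h₁ (lt_sub_iff_add_lt.mpr hαβ))
    exact eq_on_Ioc_of_step (by linarith) R.dirPlus_spec R.dir_left
      (hstart s hs (lt_sub_iff_add_lt.mp (hs'.trans_le (min_le_right _ _))))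
      (fun u hu hu' => hkeep u (hs.trans hu) hu') t (hs'.trans_le (min_le_left _ _)) h₂
  have hgate : ∀ t, α < t → t ≤ γ → R.gate t = GateV.opened → R.gatePlus t = GateV.opened := by
    intro t h₁ h₂ h
    rcases R.gate_step t (by linarith) with h' | h' | h'
    · exact h'.trans h
    · exact h'.2
    · simp [hdir t h₁ h₂] at h'
  obtain ⟨u, ⟨hαu, huα⟩, hu⟩ : ∃ u ∈ Set.Ioo α (α + dopen), R.gate u = GateV.opened := by
    by_contra! hcon
    refine R.gate_open_bound α hα fun u hu => ⟨hdir u hu.1 (by linarith [hu.2]), ?_⟩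
    cases hg : R.gate u with
    | opened => exact absurd hg (hcon u hu)
    | closed => rfl
  rintro t ⟨ht, ht'⟩
  exact eq_on_Ioc_of_step (by linarith) R.gatePlus_spec R.gate_left
    (hgate u hαu (by linarith) hu) (fun s hs hs' => hgate s (hαu.trans hs) hs'.le) t
    (by linarith) ht'

end RailCross
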